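/- Let ε > 0, g > 0, and η with e^{−ε} < η ≤ 1, and set M = η·g/(η − e^{−ε}). Then the pair (μ_B, μ_U) with μ_B = Unif(g, M) and μ_U = (1−η)·δ₀ + η·Unif(0, M) (the zero-inflated uniform distribution with parameter η) is (ε, g)-one-sided indistinguishable. -/

import Mathlib

open MeasureTheory Set Real

/-- (ε,g)-one-sided indistinguishability. -/
def OSIndist (ε g : ℝ) (μB μU : Measure ℝ) : Prop :=
  μB (Set.Iio 0) = 0 ∧ μU (Set.Iio 0) = 0 ∧
  ∀ S : Set ℝ, MeasurableSet S → ∀ t₀ ∈ Set.Icc (0 : ℝ) g,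
    μB S ≤ ENNReal.ofReal (Real.exp ε) * μU ((· + t₀) ⁻¹' S)

/-- The uniform probability measure on `[a,b]` (density `1/(b−a)` on `[a,b]`). -/
noncomputable def unif (a b : ℝ) : Measure ℝ :=
  (ENNReal.ofReal (b - a))⁻¹ • volume.restrict (Set.Icc a b)

theorem unif_Iio_zero {a : ℝ} (b : ℝ) (ha : 0 ≤ a) : unif a b (Set.Iio 0) = 0 := by
  have h : Set.Iio (0 : ℝ) ∩ Set.Icc a b = ∅ := by
    ext x
    simp only [Set.mem_inter_iff, Set.mem_Iio, Set.mem_Icc, Set.mem_empty_iff_false, iff_false]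
    rintro ⟨h1, h2, -⟩
    linarith
  simp [unif, Measure.restrict_apply measurableSet_Iio, h]

theorem volume_restrict_Icc_le_shift {g M t : ℝ} (ht : t ∈ Set.Icc 0 g) {S : Set ℝ}
    (hS : MeasurableSet S) :
    volume.restrict (Set.Icc g M) S ≤ volume.restrict (Set.Icc 0 M) ((· + t) ⁻¹' S) := by
  rw [Measure.restrict_apply hS, Measure.restrict_apply (measurable_add_const t hS),
    ← measure_preimage_add_right volume t (S ∩ Set.Icc g M)]
  refine measure_mono ?_
  rintro x ⟨hx, h1, h2⟩
  obtain ⟨h3, h4⟩ := ht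
  exact ⟨hx, by linarith, by linarith⟩

theorem stmt3 (ε g η : ℝ) (hε : 0 < ε) (hg : 0 < g)
    (hη : Real.exp (-ε) < η) (hη1 : η ≤ 1) :
    OSIndist ε g (unif g (η * g / (η - Real.exp (-ε))))
      (ENNReal.ofReal (1 - η) • Measure.dirac (0 : ℝ) +
        ENNReal.ofReal η • unif 0 (η * g / (η - Real.exp (-ε)))) := by
  have hexp : 0 < Real.exp (-ε) := Real.exp_pos _
  have hη0 : 0 < η := hexp.trans hη
  have hd : 0 < η - Real.exp (-ε) := sub_pos.2 hη
  set M := η * g / (η - Real.exp (-ε)) with hM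
  have hM0 : 0 < M := by positivity
  have hMg : M - g = Real.exp (-ε) * M / η := by
    rw [hM]
    field_simp
    ring
  have hMg0 : 0 < M - g := by rw [hMg]; positivity
  have hscale : (ENNReal.ofReal (M - g))⁻¹ =
      ENNReal.ofReal (Real.exp ε) * (ENNReal.ofReal η * (ENNReal.ofReal (M - 0))⁻¹) := by
    rw [sub_zero, ← ENNReal.ofReal_inv_of_pos hMg0, ← ENNReal.ofReal_inv_of_pos hM0,
      ← ENNReal.ofReal_mul hη0.le, ← ENNReal.ofReal_mul (Real.exp_pos ε).le, hMg, Real.exp_neg]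
    congr 1
    field_simp
  refine ⟨unif_Iio_zero _ hg.le, by simp [unif_Iio_zero _ le_rfl], fun S hS t ht => ?_⟩
  calc unif g M S
      = (ENNReal.ofReal (M - g))⁻¹ * volume.restrict (Set.Icc g M) S := rfl
    _ ≤ (ENNReal.ofReal (M - g))⁻¹ * volume.restrict (Set.Icc 0 M) ((· + t) ⁻¹' S) :=
        mul_le_mul_right (volume_restrict_Icc_le_shift ht hS) _
    _ = ENNReal.ofReal (Real.exp ε) *
          (ENNReal.ofReal η • unif 0 M) ((· + t) ⁻¹' S) := by
        simp only [unif, Measure.smul_apply, smul_eq_mul, hscale, mul_assoc]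
    _ ≤ _ := by
        refine mul_le_mul_right ?_ _
        rw [Measure.add_apply]
        exact le_add_self
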